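/- arXiv:1901.07847 — 2 statements merged into one kernel-verified Lean document; each statement's English description precedes it below -/
import Mathlib

section
/- (Generalized Fekete lemma, supermultiplicative version.) Let k be a natural number and let a_{m,n} (m,n positive integers) be a double sequence of real numbers with a_{m,n} ≥ 1 for all m,n. Suppose that a_{m₁,n} · a_{m₂,n} ≤ a_{m₁+m₂+k, n} and a_{m,n₁} · a_{m,n₂} ≤ a_{m, n₁+n₂+k} for all positive integers m, m₁, m₂, n, n₁, n₂, and suppose that S = sup_{m,n ≥ 1} (a_{m,n})^{1/((m+k)(n+k))} is finite. Then lim_{m,n→∞} (a_{m,n})^{1/(mn)} exists (with respect to the product filter of m → ∞ and n → ∞) and equals S. -/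
/-- Iterating a shifted superadditive inequality. -/
lemma mul_le_of_shifted_superadditive {k : ℕ} {g : ℕ → ℝ} (hg : ∀ m, 0 < m → 0 ≤ g m)
    (hadd : ∀ m₁ m₂, 0 < m₁ → 0 < m₂ → g m₁ + g m₂ ≤ g (m₁ + m₂ + k))
    {m₀ : ℕ} (hm₀ : 0 < m₀) (q m : ℕ) (hm : q * (m₀ + k) < m) : q * g m₀ ≤ g m := by
  induction q generalizing m with
  | zero => simpa using hg m (by omega)
  | succ q ih =>
    obtain ⟨r, rfl⟩ : ∃ r, m = r + m₀ + k :=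
      ⟨m - (m₀ + k), by rw [Nat.succ_mul] at hm; omega⟩
    have hr : q * (m₀ + k) < r := by rw [Nat.succ_mul] at hm; omega
    have h₁ := ih r hr
    have h₂ := hadd r m₀ (by omega) hm₀
    push_cast
    linarith

lemma sub_mul_le_of_shifted_superadditive {k : ℕ} {g : ℕ → ℝ} (hg : ∀ m, 0 < m → 0 ≤ g m)
    (hadd : ∀ m₁ m₂, 0 < m₁ → 0 < m₂ → g m₁ + g m₂ ≤ g (m₁ + m₂ + k))
    {m₀ m : ℕ} (hm₀ : 0 < m₀) (hm : 0 < m) :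
    (1 - ((m₀ + k : ℕ) : ℝ) / m) * (g m₀ / (m₀ + k : ℕ)) ≤ g m / m := by
  have hM : (0 : ℝ) < (m₀ + k : ℕ) := by exact_mod_cast (by omega : 0 < m₀ + k)
  have hm' : (0 : ℝ) < m := by exact_mod_cast hm
  have hdiv := Nat.div_add_mod (m - 1) (m₀ + k)
  have hmod := Nat.mod_lt (m - 1) (by omega : 0 < m₀ + k)
  set q := (m - 1) / (m₀ + k)
  have hq := mul_le_of_shifted_superadditive hg hadd hm₀ q m (by rw [mul_comm]; omega)
  have hmq : (m : ℝ) ≤ (m₀ + k : ℕ) * q + (m₀ + k : ℕ) := by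
    exact_mod_cast (by omega : m ≤ (m₀ + k) * q + (m₀ + k))
  have h : (m - ((m₀ + k : ℕ) : ℝ)) * g m₀ ≤ (m₀ + k : ℕ) * g m :=
    calc (m - ((m₀ + k : ℕ) : ℝ)) * g m₀ ≤ ((m₀ + k : ℕ) * q) * g m₀ :=
          mul_le_mul_of_nonneg_right (by linarith) (hg m₀ hm₀)
      _ = (m₀ + k : ℕ) * (q * g m₀) := by ring
      _ ≤ _ := mul_le_mul_of_nonneg_left hq hM.le
  rw [one_sub_div hm'.ne', div_mul_div_comm, div_le_div_iff₀ (by positivity) hm']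
  calc _ = ((m - ((m₀ + k : ℕ) : ℝ)) * g m₀) * m := by ring
    _ ≤ ((m₀ + k : ℕ) * g m) * m := mul_le_mul_of_nonneg_right h hm'.le
    _ = _ := by ring

open Filter in
/-- The additive form of the two-parameter Fekete lemma. -/
theorem tendsto_div_mul_of_shifted_superadditive {k : ℕ} {f : ℕ → ℕ → ℝ}
    (hf : ∀ m n, 0 < m → 0 < n → 0 ≤ f m n)
    (hrow : ∀ m₁ m₂ n, 0 < m₁ → 0 < m₂ → 0 < n → f m₁ n + f m₂ n ≤ f (m₁ + m₂ + k) n)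
    (hcol : ∀ m n₁ n₂, 0 < m → 0 < n₁ → 0 < n₂ → f m n₁ + f m n₂ ≤ f m (n₁ + n₂ + k))
    {s : ℝ} (hs : IsLUB {x : ℝ | ∃ m n : ℕ, 0 < m ∧ 0 < n ∧
      x = f m n / (((m : ℝ) + k) * ((n : ℝ) + k))} s) :
    Tendsto (fun p : ℕ × ℕ => f p.1 p.2 / ((p.1 : ℝ) * (p.2 : ℝ)))
      (atTop ×ˢ atTop) (nhds s) := by
  have hlim (c : ℝ) : Tendsto (fun n : ℕ => c / (n : ℝ)) atTop (nhds 0) :=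
    tendsto_const_div_atTop_nhds_zero_nat c
  have hpos : ∀ᶠ p : ℕ × ℕ in atTop ×ˢ atTop, 0 < p.1 ∧ 0 < p.2 :=
    (eventually_gt_atTop 0).prod_mk (eventually_gt_atTop 0)
  refine tendsto_order.2 ⟨fun b hb => ?_, fun b hb => ?_⟩
  · obtain ⟨_, ⟨m₀, n₀, hm₀, hn₀, rfl⟩, hbx, -⟩ := hs.exists_between hb
    have h₁ := (tendsto_const_nhds (x := (1 : ℝ))).sub (hlim ((m₀ + k : ℕ) : ℝ))
    have h₂ := (tendsto_const_nhds (x := (1 : ℝ))).sub (hlim ((n₀ + k : ℕ) : ℝ))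
    have h := ((h₁.comp (tendsto_fst (g := atTop (α := ℕ)))).mul
      (h₂.comp (tendsto_snd (f := atTop (α := ℕ))))).mul_const
      (f m₀ n₀ / (((m₀ : ℝ) + k) * ((n₀ : ℝ) + k)))
    have hbig : ∀ᶠ p : ℕ × ℕ in atTop ×ˢ atTop, m₀ + k ≤ p.1 ∧ 0 < p.2 :=
      (eventually_ge_atTop _).prod_mk (eventually_gt_atTop 0)
    filter_upwards [h.eventually_const_lt (u := b) (by simpa using hbx), hbig]
    rintro ⟨m, n⟩ hp ⟨hm, hn⟩
    refine hp.trans_le ?_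
    simp only [Function.comp_apply] at hm hn ⊢
    have hm' : 0 < m := by omega
    have hm'' : (0 : ℝ) < m := by exact_mod_cast hm'
    have e₁ := sub_mul_le_of_shifted_superadditive (g := fun i => f i n)
      (fun i hi => hf i n hi hn) (fun i j hi hj => hrow i j n hi hj hn) hm₀ hm'
    have e₂ := sub_mul_le_of_shifted_superadditive (g := fun j => f m₀ j)
      (fun j hj => hf m₀ j hm₀ hj) (fun i j hi hj => hcol m₀ i j hm₀ hi hj) hn₀ hn
    have hc : 0 ≤ (1 - ((m₀ + k : ℕ) : ℝ) / m) / ((m₀ + k : ℕ) : ℝ) := by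
      refine div_nonneg (sub_nonneg.2 ((div_le_one hm'').2 ?_)) (Nat.cast_nonneg _)
      exact_mod_cast hm
    calc _ = (1 - ((m₀ + k : ℕ) : ℝ) / m) / ((m₀ + k : ℕ) : ℝ) *
          ((1 - ((n₀ + k : ℕ) : ℝ) / n) * (f m₀ n₀ / (n₀ + k : ℕ))) := by
            push_cast; simp only [div_eq_mul_inv, mul_inv]; ring
      _ ≤ (1 - ((m₀ + k : ℕ) : ℝ) / m) / ((m₀ + k : ℕ) : ℝ) * (f m₀ n / n) :=
          mul_le_mul_of_nonneg_left e₂ hc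
      _ = ((1 - ((m₀ + k : ℕ) : ℝ) / m) * (f m₀ n / (m₀ + k : ℕ))) / n := by ring
      _ ≤ (f m n / m) / n := div_le_div_of_nonneg_right e₁ (Nat.cast_nonneg _)
      _ = _ := div_div _ _ _
  · have h₁ := (tendsto_const_nhds (x := (1 : ℝ))).add (hlim (k : ℝ))
    have h := ((h₁.comp (tendsto_fst (g := atTop (α := ℕ)))).mul
      (h₁.comp (tendsto_snd (f := atTop (α := ℕ))))).const_mul s
    filter_upwards [h.eventually_lt_const (u := b) (by simpa using hb), hpos]
    rintro ⟨m, n⟩ hp ⟨hm, hn⟩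
    refine lt_of_le_of_lt ?_ hp
    simp only [Function.comp_apply] at hm hn ⊢
    have hm' : (0 : ℝ) < m := by exact_mod_cast hm
    have hn' : (0 : ℝ) < n := by exact_mod_cast hn
    have hle := hs.1 ⟨m, n, hm, hn, rfl⟩
    rw [div_le_iff₀ (by positivity)] at hle
    rw [div_le_iff₀ (by positivity)]
    refine hle.trans_eq ?_
    field_simp


open Filter in
/-- **Generalized Fekete lemma (supermultiplicative version).**
If `a_{m,n} ≥ 1` and `a_{m₁,n} a_{m₂,n} ≤ a_{m₁+m₂+k,n}`,
`a_{m,n₁} a_{m,n₂} ≤ a_{m,n₁+n₂+k}` for all positive indices, and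
`S = sup_{m,n ≥ 1} a_{m,n}^{1/((m+k)(n+k))}` is finite, then
`a_{m,n}^{1/(mn)} → S` as `m, n → ∞` (product filter). -/
theorem generalized_fekete_supermultiplicative (k : ℕ) (a : ℕ → ℕ → ℝ)
    (ha : ∀ m n : ℕ, 0 < m → 0 < n → 1 ≤ a m n)
    (hrow : ∀ m₁ m₂ n : ℕ, 0 < m₁ → 0 < m₂ → 0 < n →
      a m₁ n * a m₂ n ≤ a (m₁ + m₂ + k) n)
    (hcol : ∀ m n₁ n₂ : ℕ, 0 < m → 0 < n₁ → 0 < n₂ →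
      a m n₁ * a m n₂ ≤ a m (n₁ + n₂ + k))
    (hbdd : BddAbove {x : ℝ | ∃ m n : ℕ, 0 < m ∧ 0 < n ∧
      x = a m n ^ (1 / (((m : ℝ) + k) * ((n : ℝ) + k)))}) :
    Tendsto (fun p : ℕ × ℕ => a p.1 p.2 ^ (1 / ((p.1 : ℝ) * (p.2 : ℝ))))
      (atTop ×ˢ atTop)
      (nhds (sSup {x : ℝ | ∃ m n : ℕ, 0 < m ∧ 0 < n ∧
        x = a m n ^ (1 / (((m : ℝ) + k) * ((n : ℝ) + k)))})) := by
  set A := {x : ℝ | ∃ m n : ℕ, 0 < m ∧ 0 < n ∧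
    x = a m n ^ (1 / (((m : ℝ) + k) * ((n : ℝ) + k)))}
  have hpos (m n : ℕ) (hm : 0 < m) (hn : 0 < n) : 0 < a m n := one_pos.trans_le (ha m n hm hn)
  have hexp (m n : ℕ) (hm : 0 < m) (hn : 0 < n) (c : ℝ) :
      a m n ^ (1 / c) = Real.exp (Real.log (a m n) / c) := by
    rw [Real.rpow_def_of_pos (hpos m n hm hn), mul_one_div]
  have hA : IsLUB A (sSup A) := isLUB_csSup ⟨_, 1, 1, one_pos, one_pos, rfl⟩ hbdd
  have hS : 0 < sSup A :=
    (Real.rpow_pos_of_pos (hpos 1 1 one_pos one_pos) _).trans_le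
      (hA.1 ⟨1, 1, one_pos, one_pos, rfl⟩)
  have hlog : IsLUB {x : ℝ | ∃ m n : ℕ, 0 < m ∧ 0 < n ∧
      x = Real.log (a m n) / (((m : ℝ) + k) * ((n : ℝ) + k))} (Real.log (sSup A)) := by
    constructor
    · rintro _ ⟨m, n, hm, hn, rfl⟩
      rw [Real.le_log_iff_exp_le hS, ← hexp m n hm hn]
      exact hA.1 ⟨m, n, hm, hn, rfl⟩
    · intro u hu
      rw [Real.log_le_iff_le_exp hS]
      refine hA.2 ?_
      rintro _ ⟨m, n, hm, hn, rfl⟩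
      rw [hexp m n hm hn, Real.exp_le_exp]
      exact hu ⟨m, n, hm, hn, rfl⟩
  have key := tendsto_div_mul_of_shifted_superadditive (f := fun m n => Real.log (a m n))
    (fun m n hm hn => Real.log_nonneg (ha m n hm hn))
    (fun m₁ m₂ n h₁ h₂ hn => by
      have p₁ := hpos m₁ n h₁ hn
      have p₂ := hpos m₂ n h₂ hn
      rw [← Real.log_mul p₁.ne' p₂.ne']
      exact Real.log_le_log (mul_pos p₁ p₂) (hrow m₁ m₂ n h₁ h₂ hn))
    (fun m n₁ n₂ hm h₁ h₂ => by
      have p₁ := hpos m n₁ hm h₁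
      have p₂ := hpos m n₂ hm h₂
      rw [← Real.log_mul p₁.ne' p₂.ne']
      exact Real.log_le_log (mul_pos p₁ p₂) (hcol m n₁ n₂ hm h₁ h₂)) hlog
  have hlim := (Real.continuous_exp.tendsto _).comp key
  rw [Real.exp_log hS] at hlim
  refine hlim.congr' ?_
  filter_upwards [(eventually_gt_atTop 0).prod_mk (eventually_gt_atTop 0)] with p hp
  exact (hexp p.1 p.2 hp.1 hp.2 _).symm
end

section
/- (Generalized Fekete lemma, submultiplicative version.) Let k be a natural number and let a_{m,n} (m,n positive integers) be a double sequence of real numbers with a_{m,n} ≥ 1 for all m,n. Suppose that a_{m₁+m₂, n} ≤ a_{m₁+k, n} · a_{m₂,n} and a_{m, n₁+n₂} ≤ a_{m, n₁+k} · a_{m,n₂} for all positive integers m, m₁, m₂, n, n₁, n₂. Then lim_{m,n→∞} (a_{m,n})^{1/(mn)} exists (with respect to the product filter of m → ∞ and n → ∞) and equals inf_{m,n > k} (a_{m,n})^{1/((m−k)(n−k))}. -/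
open Filter Topology

/-- Iterating `u (d + m) ≤ u (d + k) + u m` bounds `u` along the progression `q * d + r`. -/
lemma le_mul_add_of_shifted_subadditive {k : ℕ} {u : ℕ → ℝ}
    (hu : ∀ m₁ m₂ : ℕ, 0 < m₁ → 0 < m₂ → u (m₁ + m₂) ≤ u (m₁ + k) + u m₂)
    {d r : ℕ} (hd : 0 < d) (hr : 0 < r) (q : ℕ) :
    u (q * d + r) ≤ q * u (d + k) + u r := by
  induction q with
  | zero => simp
  | succ q ih =>
    have h := hu d (q * d + r) hd (by omega)
    rw [show (q + 1) * d + r = d + (q * d + r) by ring]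
    push_cast
    linarith

/-- Every positive integer is `q * d + r` with `1 ≤ r ≤ d`. -/
lemma exists_eq_mul_add_pos_remainder {d m : ℕ} (hd : 0 < d) (hm : 0 < m) :
    ∃ q r : ℕ, 0 < r ∧ r ≤ d ∧ m = q * d + r := by
  refine ⟨(m - 1) / d, (m - 1) % d + 1, by omega, Nat.mod_lt _ hd, ?_⟩
  have h := Nat.div_add_mod' (m - 1) d
  omega

/-- Up to terms vanishing at infinity, `b m n / (m * n)` is at most `b (d + k) (e + k) / (d * e)`. -/
lemma exists_bound_of_shifted_subadditive {k : ℕ} {b : ℕ → ℕ → ℝ}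
    (hb : ∀ m n : ℕ, 0 < m → 0 < n → 0 ≤ b m n)
    (hrow : ∀ m₁ m₂ n : ℕ, 0 < m₁ → 0 < m₂ → 0 < n →
      b (m₁ + m₂) n ≤ b (m₁ + k) n + b m₂ n)
    (hcol : ∀ m n₁ n₂ : ℕ, 0 < m → 0 < n₁ → 0 < n₂ →
      b m (n₁ + n₂) ≤ b m (n₁ + k) + b m n₂)
    {d e : ℕ} (hd : 0 < d) (he : 0 < e) :
    ∃ C : ℝ, ∀ m n : ℕ, 0 < m → 0 < n →
      b m n / (m * n) ≤ b (d + k) (e + k) / (d * e) + C / n + C / m + C / (m * n) := by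
  obtain ⟨C, hC⟩ := ((Finset.range (d + k + 1) ×ˢ Finset.range (e + k + 1)).image
    fun p : ℕ × ℕ => b p.1 p.2).bddAbove
  have hC' : ∀ i j : ℕ, i ≤ d + k → j ≤ e + k → b i j ≤ C := fun i j hi hj =>
    hC (Finset.mem_coe.2 (Finset.mem_image.2 ⟨(i, j), by simp; omega, rfl⟩))
  have hB := hb (d + k) (e + k) (by omega) (by omega)
  have hC0 : 0 ≤ C := hB.trans (hC' _ _ le_rfl le_rfl)
  refine ⟨C, fun m n hm hn => ?_⟩
  obtain ⟨q, r, hr, hrd, hmq⟩ := exists_eq_mul_add_pos_remainder hd hm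
  obtain ⟨q', r', hr', hre, hnq⟩ := exists_eq_mul_add_pos_remainder he hn
  have h₁ : b m n ≤ q * b (d + k) n + b r n := by
    rw [hmq]
    exact le_mul_add_of_shifted_subadditive (u := fun i => b i n)
      (fun i j hi hj => hrow i j n hi hj hn) hd hr q
  have hn_le : ∀ i, 0 < i → b i n ≤ q' * b i (e + k) + b i r' := fun i hi => by
    rw [hnq]
    exact le_mul_add_of_shifted_subadditive (hcol i · · hi) he hr' q'
  have h₂ : b (d + k) n ≤ q' * b (d + k) (e + k) + C :=
    (hn_le _ (by omega)).trans (by gcongr; exact hC' _ _ le_rfl (by omega))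
  have h₃ : b r n ≤ q' * C + C :=
    (hn_le _ hr).trans (by gcongr <;> exact hC' _ _ (by omega) (by omega))
  have hd' : (1 : ℝ) ≤ d := by exact_mod_cast hd
  have he' : (1 : ℝ) ≤ e := by exact_mod_cast he
  have hm' : (0 : ℝ) < m := by exact_mod_cast hm
  have hn' : (0 : ℝ) < n := by exact_mod_cast hn
  have hqm : (q : ℝ) * d ≤ m := by exact_mod_cast (by omega : q * d ≤ m)
  have hqn : (q' : ℝ) * e ≤ n := by exact_mod_cast (by omega : q' * e ≤ n)
  have hq0 : (0 : ℝ) ≤ q := q.cast_nonneg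
  have hq0' : (0 : ℝ) ≤ q' := q'.cast_nonneg
  have hqm' : (q : ℝ) ≤ m := by nlinarith
  have hqn' : (q' : ℝ) ≤ n := by nlinarith
  have hqq : (q : ℝ) * q' * b (d + k) (e + k) ≤ m * n * (b (d + k) (e + k) / (d * e)) := by
    calc (q : ℝ) * q' * b (d + k) (e + k)
        = (q * d) * (q' * e) * (b (d + k) (e + k) / (d * e)) := by field_simp
      _ ≤ m * n * (b (d + k) (e + k) / (d * e)) := by gcongr
  have hbmn : b m n ≤ m * n * (b (d + k) (e + k) / (d * e)) + m * C + n * C + C := by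
    have := mul_le_mul_of_nonneg_left h₂ hq0
    have := mul_le_mul_of_nonneg_right hqm' hC0
    have := mul_le_mul_of_nonneg_right hqn' hC0
    linarith
  calc b m n / (m * n)
      ≤ (m * n * (b (d + k) (e + k) / (d * e)) + m * C + n * C + C) / (m * n) := by gcongr
    _ = _ := by field_simp

/-- Generalized Fekete lemma, subadditive version. -/
lemma tendsto_div_of_shifted_subadditive {k : ℕ} {b : ℕ → ℕ → ℝ} {l : ℝ}
    (hb : ∀ m n : ℕ, 0 < m → 0 < n → 0 ≤ b m n)
    (hrow : ∀ m₁ m₂ n : ℕ, 0 < m₁ → 0 < m₂ → 0 < n →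
      b (m₁ + m₂) n ≤ b (m₁ + k) n + b m₂ n)
    (hcol : ∀ m n₁ n₂ : ℕ, 0 < m → 0 < n₁ → 0 < n₂ →
      b m (n₁ + n₂) ≤ b m (n₁ + k) + b m n₂)
    (hl : IsGLB {x : ℝ | ∃ m n : ℕ, k < m ∧ k < n ∧
      x = b m n / (((m : ℝ) - k) * ((n : ℝ) - k))} l) :
    Tendsto (fun p : ℕ × ℕ => b p.1 p.2 / ((p.1 : ℝ) * p.2)) (atTop ×ˢ atTop) (𝓝 l) := by
  have hfst : Tendsto (fun p : ℕ × ℕ => (p.1 : ℝ)) (atTop ×ˢ atTop) atTop :=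
    tendsto_natCast_atTop_atTop.comp tendsto_fst
  have hsnd : Tendsto (fun p : ℕ × ℕ => (p.2 : ℝ)) (atTop ×ˢ atTop) atTop :=
    tendsto_natCast_atTop_atTop.comp tendsto_snd
  have hlarge : ∀ᶠ p : ℕ × ℕ in atTop ×ˢ atTop, k < p.1 ∧ k < p.2 :=
    (eventually_gt_atTop k).prod_mk (eventually_gt_atTop k)
  refine tendsto_order.2 ⟨fun x hx => ?_, fun x hx => ?_⟩
  · have hlim : Tendsto (fun p : ℕ × ℕ => l * ((1 - (k : ℝ) / p.1) * (1 - (k : ℝ) / p.2)))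
        (atTop ×ˢ atTop) (𝓝 l) := by
      simpa using (((hfst.const_div_atTop (k : ℝ)).const_sub 1).mul
        ((hsnd.const_div_atTop (k : ℝ)).const_sub 1)).const_mul l
    filter_upwards [hlim.eventually_const_lt hx, hlarge] with ⟨m, n⟩ h ⟨hm, hn⟩
    refine h.trans_le ?_
    have hkm : (0 : ℝ) < m - k := sub_pos.2 (by exact_mod_cast hm)
    have hkn : (0 : ℝ) < n - k := sub_pos.2 (by exact_mod_cast hn)
    have hm' : (0 : ℝ) < m := by exact_mod_cast (by omega : 0 < m)
    have hn' : (0 : ℝ) < n := by exact_mod_cast (by omega : 0 < n)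
    have hle := (le_div_iff₀ (mul_pos hkm hkn)).1 (hl.1 ⟨m, n, hm, hn, rfl⟩)
    rw [le_div_iff₀ (mul_pos hm' hn')]
    refine le_trans (le_of_eq ?_) hle
    field_simp
  · obtain ⟨_, ⟨m₀, n₀, hm₀, hn₀, rfl⟩, -, hlt⟩ := hl.exists_between hx
    obtain ⟨C, hC⟩ := exists_bound_of_shifted_subadditive hb hrow hcol
      (Nat.sub_pos_of_lt hm₀) (Nat.sub_pos_of_lt hn₀)
    rw [Nat.sub_add_cancel hm₀.le, Nat.sub_add_cancel hn₀.le, Nat.cast_sub hm₀.le,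
      Nat.cast_sub hn₀.le] at hC
    have hlim := ((hsnd.const_div_atTop C).const_add
      (b m₀ n₀ / (((m₀ : ℝ) - k) * ((n₀ : ℝ) - k)))).add (hfst.const_div_atTop C)
    have hlim := hlim.add ((hfst.atTop_mul_atTop₀ hsnd).const_div_atTop C)
    simp only [add_zero] at hlim
    filter_upwards [hlim.eventually_lt_const hlt, hlarge] with ⟨m, n⟩ h ⟨hm, hn⟩
    exact (hC m n (by omega) (by omega)).trans_lt h


open Filter in
/-- **Generalized Fekete lemma (submultiplicative version).**
If `a_{m,n} ≥ 1` and `a_{m₁+m₂,n} ≤ a_{m₁+k,n} a_{m₂,n}`,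
`a_{m,n₁+n₂} ≤ a_{m,n₁+k} a_{m,n₂}` for all positive indices, then
`a_{m,n}^{1/(mn)} → inf_{m,n > k} a_{m,n}^{1/((m−k)(n−k))}` as `m, n → ∞`
(product filter). -/
theorem generalized_fekete_submultiplicative (k : ℕ) (a : ℕ → ℕ → ℝ)
    (ha : ∀ m n : ℕ, 0 < m → 0 < n → 1 ≤ a m n)
    (hrow : ∀ m₁ m₂ n : ℕ, 0 < m₁ → 0 < m₂ → 0 < n →
      a (m₁ + m₂) n ≤ a (m₁ + k) n * a m₂ n)
    (hcol : ∀ m n₁ n₂ : ℕ, 0 < m → 0 < n₁ → 0 < n₂ →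
      a m (n₁ + n₂) ≤ a m (n₁ + k) * a m n₂) :
    Tendsto (fun p : ℕ × ℕ => a p.1 p.2 ^ (1 / ((p.1 : ℝ) * (p.2 : ℝ))))
      (atTop ×ˢ atTop)
      (nhds (sInf {x : ℝ | ∃ m n : ℕ, k < m ∧ k < n ∧
        x = a m n ^ (1 / (((m : ℝ) - k) * ((n : ℝ) - k)))})) := by
  have hlog : ∀ m n : ℕ, 0 < m → 0 < n → ∀ c : ℝ,
      a m n ^ (1 / c) = Real.exp (Real.log (a m n) / c) := fun m n hm hn c => by
    rw [Real.rpow_def_of_pos (by linarith [ha m n hm hn]), mul_one_div]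
  have hmul : ∀ x y z : ℝ, 1 ≤ x → 1 ≤ y → 1 ≤ z → x ≤ y * z →
      Real.log x ≤ Real.log y + Real.log z := fun x y z hx hy hz h => by
    rw [← Real.log_mul (by positivity) (by positivity)]
    exact Real.log_le_log (by positivity) h
  set S := {x : ℝ | ∃ m n : ℕ, k < m ∧ k < n ∧
    x = Real.log (a m n) / (((m : ℝ) - k) * ((n : ℝ) - k))}
  have hSne : S.Nonempty := ⟨_, k + 1, k + 1, by omega, by omega, rfl⟩
  have hSbdd : BddBelow S := by
    refine ⟨0, ?_⟩
    rintro _ ⟨m, n, hm, hn, rfl⟩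
    have hkm : (0 : ℝ) < m - k := sub_pos.2 (by exact_mod_cast hm)
    have hkn : (0 : ℝ) < n - k := sub_pos.2 (by exact_mod_cast hn)
    exact div_nonneg (Real.log_nonneg (ha m n (by omega) (by omega))) (by positivity)
  have himage : {x : ℝ | ∃ m n : ℕ, k < m ∧ k < n ∧
      x = a m n ^ (1 / (((m : ℝ) - k) * ((n : ℝ) - k)))} = Real.exp '' S := by
    ext x
    constructor
    · rintro ⟨m, n, hm, hn, rfl⟩
      exact ⟨_, ⟨m, n, hm, hn, rfl⟩, (hlog m n (by omega) (by omega) _).symm⟩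
    · rintro ⟨_, ⟨m, n, hm, hn, rfl⟩, rfl⟩
      exact ⟨m, n, hm, hn, (hlog m n (by omega) (by omega) _).symm⟩
  rw [himage, ← Real.exp_monotone.map_csInf_of_continuousAt
    Real.continuous_exp.continuousAt hSne hSbdd]
  have hlim := tendsto_div_of_shifted_subadditive (b := fun m n => Real.log (a m n))
    (fun m n hm hn => Real.log_nonneg (ha m n hm hn))
    (fun m₁ m₂ n h₁ h₂ hn => hmul _ _ _ (ha _ _ (by omega) hn) (ha _ _ (by omega) hn)
      (ha _ _ h₂ hn) (hrow m₁ m₂ n h₁ h₂ hn))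
    (fun m n₁ n₂ hm h₁ h₂ => hmul _ _ _ (ha _ _ hm (by omega)) (ha _ _ hm (by omega))
      (ha _ _ hm h₂) (hcol m n₁ n₂ hm h₁ h₂))
    (isGLB_csInf hSne hSbdd)
  refine ((Real.continuous_exp.tendsto _).comp hlim).congr' ?_
  filter_upwards [(eventually_gt_atTop 0).prod_mk (eventually_gt_atTop 0)] with ⟨m, n⟩ ⟨hm, hn⟩
  exact (hlog m n hm hn _).symm
end
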